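/- For all integers n ≥ 4 and 0 ≤ s ≤ ⌊(n−4)/2⌋, the Wiener index of B(n,s) is W(B(n,s)) = n(n−1)(n−2)/6 + (s+1)(s+2)/2 + (n−s−3)(n−s−2)/2 + 1. -/

import Mathlib

open SimpleGraph Finset
open scoped Classical

noncomputable section

/-- The Wiener index of a graph, as a rational number: half of the sum of
distances over all ordered pairs of vertices (i.e. the sum over unordered pairs). -/
def wienerIndex {V : Type*} [Fintype V] (G : SimpleGraph V) : ℚ :=
  (∑ u : V, ∑ v : V, (G.dist u v : ℚ)) / 2

/-- The transmission `D_G(v)` of a vertex: the sum of distances to all vertices. -/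
def transmission {V : Type*} [Fintype V] (G : SimpleGraph V) (v : V) : ℚ :=
  ∑ x : V, (G.dist x v : ℚ)

/-- `n_u(e)` for `e = uv`: the number of vertices strictly closer to `u` than to `v`. -/
def nCloser {V : Type*} [Fintype V] (G : SimpleGraph V) (u v : V) : ℕ :=
  (Finset.univ.filter fun w => G.dist u w < G.dist v w).card

/-- `n_0(e)` for `e = uv`: the number of vertices equidistant from `u` and `v`. -/
def nEqual {V : Type*} [Fintype V] (G : SimpleGraph V) (u v : V) : ℕ :=
  (Finset.univ.filter fun w => G.dist u w = G.dist v w).card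

/-- The Szeged index, as a rational number (each edge is counted once). -/
def szeged {V : Type*} [Fintype V] (G : SimpleGraph V) : ℚ :=
  (∑ u : V, ∑ v : V,
    if G.Adj u v then (nCloser G u v : ℚ) * (nCloser G v u : ℚ) else 0) / 2

/-- The revised Szeged index, as a rational number (each edge is counted once). -/
def szegedStar {V : Type*} [Fintype V] (G : SimpleGraph V) : ℚ :=
  (∑ u : V, ∑ v : V,
    if G.Adj u v then
      ((nCloser G u v : ℚ) + (nEqual G u v : ℚ) / 2) *
        ((nCloser G v u : ℚ) + (nEqual G u v : ℚ) / 2)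
    else 0) / 2

/-- The cycle `C_k` on the vertices `0, 1, …, k-1`. -/
def cycleG (k : ℕ) : SimpleGraph (Fin k) :=
  SimpleGraph.fromRel (fun a b => a.val + 1 = b.val ∨ (a.val = 0 ∧ b.val = k - 1))

/-- The lollipop `L_{n,r}`: the cycle `C_r` on `0, …, r-1` together with the
path `r-1, r, …, n-1` attached at the cycle vertex `r-1`. -/
def lollipop (n r : ℕ) : SimpleGraph (Fin n) :=
  SimpleGraph.fromRel (fun a b => a.val + 1 = b.val ∨ (a.val = 0 ∧ b.val = r - 1))

/-- `H_n^0`: a triangle `0,1,2`, a path `2, 3, …, n-3` (so `u_1 = 2`, `u_{n-4} = n-3`)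
and two pendant vertices `n-2, n-1` attached at `n-3`. -/
def Hgraph0 (n : ℕ) : SimpleGraph (Fin n) :=
  SimpleGraph.fromRel (fun a b =>
    (a.val + 1 = b.val ∧ b.val ≤ n - 2) ∨ (a.val = 0 ∧ b.val = 2) ∨
    (a.val = n - 3 ∧ b.val = n - 1))

/-- `H_n^1`: a triangle `0,1,2`, a path `2, 3, …, n-4` (so `u_1 = 2`, `u_{n-5} = n-4`),
a path of length two `n-4, n-3, n-2` and a pendant vertex `n-1` attached at `n-4`. -/
def Hgraph1 (n : ℕ) : SimpleGraph (Fin n) :=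
  SimpleGraph.fromRel (fun a b =>
    (a.val + 1 = b.val ∧ b.val ≤ n - 2) ∨ (a.val = 0 ∧ b.val = 2) ∨
    (a.val = n - 4 ∧ b.val = n - 1))

/-- `H_n^2`: a `4`-cycle `0,1,2,3`, a path `3, 4, …, n-3` (so `u_1 = 3`, `u_{n-5} = n-3`)
and two pendant vertices `n-2, n-1` attached at `n-3`. -/
def Hgraph2 (n : ℕ) : SimpleGraph (Fin n) :=
  SimpleGraph.fromRel (fun a b =>
    (a.val + 1 = b.val ∧ b.val ≤ n - 2) ∨ (a.val = 0 ∧ b.val = 3) ∨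
    (a.val = n - 3 ∧ b.val = n - 1))

/-- `H_n^3`: a triangle `0,1,2`, a path `2, 3, …, n-4` (so `u_1 = 2`, `u_{n-5} = n-4`),
two pendant vertices `n-3, n-2` attached at `n-4`, and a pendant vertex `n-1`
attached at the second triangle vertex `0`. -/
def Hgraph3 (n : ℕ) : SimpleGraph (Fin n) :=
  SimpleGraph.fromRel (fun a b =>
    (a.val + 1 = b.val ∧ b.val ≤ n - 3) ∨ (a.val = 0 ∧ b.val = 2) ∨
    (a.val = n - 4 ∧ b.val = n - 2) ∨ (a.val = 0 ∧ b.val = n - 1))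

/-- `B(n,s)`: `K_4^-` on the vertices `x = n-s-4`, `u = n-s-3`, `y = n-s-2`, `v = n-1`
(with the edge `xy` missing), a path on `n-s-4` vertices `0, …, n-s-5` attached at `x`,
and a path on `s` vertices `n-s-1, …, n-2` attached at `y`. -/
def Bgraph (n s : ℕ) : SimpleGraph (Fin n) :=
  SimpleGraph.fromRel (fun a b =>
    (a.val + 1 = b.val ∧ b.val ≤ n - 2) ∨
    (b.val = n - 1 ∧ (a.val = n - s - 4 ∨ a.val = n - s - 3 ∨ a.val = n - s - 2)))

/-- `B_n^{(1)}`: `K_4^-` on the vertices `n-4, n-3, n-2, n-1` (with the edge between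
`n-2` and `n-1` missing), with an end-vertex of the path `0, 1, …, n-4` identified with
the degree-`3` vertex `n-4` of `K_4^-`. -/
def Bn1 (n : ℕ) : SimpleGraph (Fin n) :=
  SimpleGraph.fromRel (fun a b =>
    (a.val + 1 = b.val ∧ b.val ≤ n - 3) ∨
    (a.val = n - 4 ∧ b.val = n - 2) ∨ (a.val = n - 4 ∧ b.val = n - 1) ∨
    (a.val = n - 3 ∧ b.val = n - 2) ∨ (a.val = n - 3 ∧ b.val = n - 1))

/-- `B_n^{3,3}`: two triangles `0,1,2` and `n-3,n-2,n-1` joined by the path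
`2, 3, …, n-3` of length `n-5`. -/
def B33 (n : ℕ) : SimpleGraph (Fin n) :=
  SimpleGraph.fromRel (fun a b =>
    a.val + 1 = b.val ∨ (a.val = 0 ∧ b.val = 2) ∨ (a.val = n - 3 ∧ b.val = n - 1))

/-- `C_r(P_{m 0 + 1}, …, P_{m (r-1) + 1})`: the unicyclic graph obtained from the cycle
`C_r` by identifying, for each `i`, one end-vertex of a path on `m i + 1` vertices with
the `i`-th cycle vertex.  The vertex `⟨i, 0⟩` is the cycle vertex `v_i`, and `⟨i, j⟩`
for `j ≥ 1` are the remaining vertices of the path attached at `v_i`. -/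
def cyclePaths (r : ℕ) (m : Fin r → ℕ) : SimpleGraph (Σ i : Fin r, Fin (m i + 1)) :=
  SimpleGraph.fromRel (fun a b =>
    (a.2.val = 0 ∧ b.2.val = 0 ∧ (a.1.val + 1) % r = b.1.val) ∨
    (a.1 = b.1 ∧ a.2.val + 1 = b.2.val))

/-- The graph obtained from vertex-disjoint graphs `G₁`, `G₂` by identifying the
vertex `v₁` of `G₁` with the vertex `v₂` of `G₂`; the common vertex is `Sum.inl v₁`. -/
def glue {V₁ V₂ : Type*} (G₁ : SimpleGraph V₁) (G₂ : SimpleGraph V₂) (v₁ : V₁) (v₂ : V₂) :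
    SimpleGraph (V₁ ⊕ {x : V₂ // x ≠ v₂}) :=
  SimpleGraph.fromRel (fun a b =>
    match a, b with
    | Sum.inl a, Sum.inl b => G₁.Adj a b
    | Sum.inr a, Sum.inr b => G₂.Adj a.val b.val
    | Sum.inl a, Sum.inr b => a = v₁ ∧ G₂.Adj v₂ b.val
    | Sum.inr _, Sum.inl _ => False)

/-- The spider `A_{n,4}`: a center `n-5` with one leg `n-5, n-6, …, 0` of length
`n-5` and four legs of length one ending at the unit leaves `n-4, n-3, n-2, n-1`;
the non-unit leaf is the vertex `0`. -/
def spiderA (n : ℕ) : SimpleGraph (Fin n) :=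
  SimpleGraph.fromRel (fun a b =>
    (a.val + 1 = b.val ∧ b.val ≤ n - 5) ∨ (a.val = n - 5 ∧ n - 4 ≤ b.val))

/-- The theta graph `B_{k,l,t}` on `k + l + t - 1` vertices: the vertices `u = 0` and
`w = k` joined by three internally disjoint paths of lengths `k`, `l`, `t`, with
internal vertices `1, …, k-1`, `k+1, …, k+l-1` and `k+l, …, k+l+t-2` respectively. -/
def theta (k l t : ℕ) : SimpleGraph (Fin (k + l + t - 1)) :=
  SimpleGraph.fromRel (fun a b =>
    (a.val + 1 = b.val ∧ b.val ≤ k) ∨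
    (a.val = 0 ∧ b.val = k + 1) ∨
    (a.val + 1 = b.val ∧ k + 1 ≤ a.val ∧ b.val ≤ k + l - 1) ∨
    (a.val = k ∧ b.val = k + l - 1) ∨
    (a.val = 0 ∧ b.val = k + l) ∨
    (a.val + 1 = b.val ∧ k + l ≤ a.val ∧ b.val ≤ k + l + t - 2) ∨
    (a.val = k ∧ b.val = k + l + t - 2))

/-- A set of vertices `B` induces a subgraph with no cut vertex. -/
def NoCutVtx {V : Type*} (G : SimpleGraph V) (B : Set V) : Prop :=
  ∀ v ∈ B, (G.induce (B \ {v})).Preconnected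

/-- `B` is (the vertex set of) a block of `G`: a maximal connected subgraph of `G`
without a cut vertex. -/
def IsBlock {V : Type*} (G : SimpleGraph V) (B : Set V) : Prop :=
  (G.induce B).Connected ∧ NoCutVtx G B ∧
  ∀ C : Set V, B ⊆ C → (G.induce C).Connected → NoCutVtx G C → C = B

/-- A function `f` that grows by at most one along edges leaving `a`, vanishes exactly at `a`,
and always decreases along some edge is the distance from `a`. -/
theorem SimpleGraph.dist_eq_of_descent {V : Type*} {G : SimpleGraph V} {a : V} {f : V → ℕ}
    (h_zero : f a = 0) (h_lip : ∀ b c, G.Adj b c → f c ≤ f b + 1)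
    (h_desc : ∀ b, b ≠ a → ∃ c, G.Adj c b ∧ f b = f c + 1) (b : V) : G.dist a b = f b := by
  have h_walk : ∀ {x y : V} (w : G.Walk x y), f y ≤ f x + w.length := by
    intro x y w
    induction w with
    | nil => simp
    | cons h w ih =>
      have := h_lip _ _ h
      rw [Walk.length_cons]
      omega
  have h_exists : ∀ k b, f b = k → ∃ w : G.Walk a b, w.length = k := by
    intro k
    induction k with
    | zero =>
      intro b hb
      by_cases hab : b = a
      · subst hab
        exact ⟨Walk.nil, rfl⟩
      · obtain ⟨c, -, hc⟩ := h_desc b hab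
        omega
    | succ k ih =>
      intro b hb
      have hab : b ≠ a := by
        rintro rfl
        omega
      obtain ⟨c, hcb, hc⟩ := h_desc b hab
      obtain ⟨w, hw⟩ := ih c (by omega)
      exact ⟨w.concat hcb, by rw [Walk.length_concat, hw]⟩
  obtain ⟨w, hw⟩ := h_exists _ b rfl
  obtain ⟨w', hw'⟩ := w.reachable.exists_walk_length_eq_dist
  have h₁ := dist_le w
  have h₂ := h_walk w'
  omega

/-- The position of a vertex of `B(t+s+4, s)` along the path `0, …, t+s+2`, where the vertex
off the path gets the position `t+1` of its twin. -/
def Bposition (t s a : ℕ) : ℕ := if a = t + s + 3 then t + 1 else a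

theorem Bgraph_adj_iff (t s : ℕ) (a b : Fin (t + s + 4)) :
    (Bgraph (t + s + 4) s).Adj a b ↔
      a ≠ b ∧ Bposition t s a ≤ Bposition t s b + 1 ∧ Bposition t s b ≤ Bposition t s a + 1 := by
  have ha := a.isLt
  have hb := b.isLt
  rw [Bgraph, fromRel_adj, Bposition, Bposition, ne_eq, Fin.ext_iff]
  split_ifs <;> omega

theorem Bgraph_dist (t s : ℕ) (a b : Fin (t + s + 4)) :
    (Bgraph (t + s + 4) s).dist a b =
      if a = b then 0 else
        max 1 ((Bposition t s a - Bposition t s b) + (Bposition t s b - Bposition t s a)) := by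
  refine dist_eq_of_descent (a := a)
    (f := fun b => if a = b then 0 else
      max 1 ((Bposition t s a - Bposition t s b) + (Bposition t s b - Bposition t s a)))
    (by simp) ?_ ?_ b
  · intro b c hbc
    rw [Bgraph_adj_iff] at hbc
    obtain ⟨hne, h₁, h₂⟩ := hbc
    split_ifs with hac hab hab
    · omega
    · omega
    · subst hab
      omega
    · omega
  · intro b hba
    by_cases h_near : Bposition t s a ≤ Bposition t s b + 1 ∧ Bposition t s b ≤ Bposition t s a + 1
    · refine ⟨a, (Bgraph_adj_iff t s a b).2 ⟨hba.symm, h_near⟩, ?_⟩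
      rw [if_neg hba.symm, if_pos rfl]
      omega
    · have h_bound : ∀ x : Fin (t + s + 4), Bposition t s x < t + s + 3 := by
        intro x
        have := x.isLt
        rw [Bposition]
        split_ifs <;> omega
      have h_path : ∀ k, k < t + s + 3 → Bposition t s k = k := by
        intro k hk
        rw [Bposition, if_neg (by omega)]
      have key : ∀ k, k < t + s + 3 →
          (k + 1 = Bposition t s b ∧ Bposition t s a < k ∨
            k = Bposition t s b + 1 ∧ k < Bposition t s a) →
          ∃ c, (Bgraph (t + s + 4) s).Adj c b ∧
            (if a = b then 0 else max 1
              ((Bposition t s a - Bposition t s b) + (Bposition t s b - Bposition t s a))) =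
            (if a = c then 0 else max 1
              ((Bposition t s a - Bposition t s c) + (Bposition t s c - Bposition t s a))) + 1 := by
        intro k hk h
        have hpk := h_path k hk
        refine ⟨⟨k, by omega⟩, (Bgraph_adj_iff t s _ b).2 ⟨?_, ?_⟩, ?_⟩
        · rintro rfl
          simp only at h
          omega
        · simp only
          omega
        · have hac : a ≠ ⟨k, by omega⟩ := by
            rintro rfl
            simp only at h
            omega
          rw [if_neg hba.symm, if_neg hac]
          simp only
          omega
      have hb := h_bound b
      rcases lt_or_ge (Bposition t s a) (Bposition t s b) with h | h
      · exact key (Bposition t s b - 1) (by omega) (by omega)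
      · have ha := h_bound a
        exact key (Bposition t s b + 1) (by omega) (by omega)

theorem sum_range_add_one_rat (k : ℕ) :
    ∑ b ∈ range k, ((b : ℚ) + 1) = (k : ℚ) * (k + 1) / 2 := by
  induction k with
  | zero => simp
  | succ k ih =>
    rw [sum_range_succ, ih]
    push_cast
    ring

theorem sum_range_abs_sub_self (k : ℕ) :
    ∑ b ∈ range k, |(b : ℚ) - k| = (k : ℚ) * (k + 1) / 2 := by
  rw [← sum_range_add_one_rat, ← sum_range_reflect]
  refine sum_congr rfl fun b hb => ?_
  have hbk : b + 1 ≤ k := mem_range.1 hb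
  rw [abs_sub_comm, Nat.sub_sub, Nat.cast_sub (by omega)]
  push_cast
  rw [abs_of_nonneg (by linarith [(Nat.cast_nonneg b : (0 : ℚ) ≤ b)])]
  ring

/-- Twice the Wiener index of the path on `m` vertices. -/
theorem sum_range_sum_range_abs_sub (m : ℕ) :
    ∑ a ∈ range m, ∑ b ∈ range m, |(a : ℚ) - b| = ((m : ℚ) + 1) * m * (m - 1) / 3 := by
  induction m with
  | zero => simp
  | succ m ih =>
    simp_rw [sum_range_succ _ m, sum_add_distrib, ih, abs_sub_comm (m : ℚ) _,
      sum_range_abs_sub_self]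
    simp
    ring

theorem sum_range_abs_sub_interior (u r : ℕ) :
    ∑ b ∈ range (u + 1 + r), |(b : ℚ) - u| = (u : ℚ) * (u + 1) / 2 + (r : ℚ) * (r + 1) / 2 := by
  rw [sum_range_add, sum_range_succ, sum_range_abs_sub_self, ← sum_range_add_one_rat r]
  have h : ∀ b : ℕ, |((u + 1 + b : ℕ) : ℚ) - u| = (b : ℚ) + 1 := by
    intro b
    push_cast
    rw [abs_of_nonneg (by linarith [(Nat.cast_nonneg b : (0 : ℚ) ≤ b)])]
    ring
  simp only [h, sub_self, abs_zero, add_zero]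

theorem Bgraph_dist_castSucc (t s : ℕ) (a b : Fin (t + s + 3)) :
    ((Bgraph (t + s + 4) s).dist a.castSucc b.castSucc : ℚ) = |((a : ℕ) : ℚ) - (b : ℕ)| := by
  have ha := a.isLt
  have hb := b.isLt
  have h : (((Bgraph (t + s + 4) s).dist a.castSucc b.castSucc : ℕ) : ℤ) =
      |((a : ℕ) : ℤ) - (b : ℕ)| := by
    rw [Bgraph_dist, Bposition, Bposition, abs_eq_max_neg]
    simp only [Fin.ext_iff, Fin.val_castSucc]
    rw [if_neg (show ¬ (a : ℕ) = t + s + 3 by omega), if_neg (show ¬ (b : ℕ) = t + s + 3 by omega)]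
    split_ifs <;> omega
  exact_mod_cast h

theorem Bgraph_dist_castSucc_last (t s : ℕ) (a : Fin (t + s + 3)) :
    ((Bgraph (t + s + 4) s).dist a.castSucc (Fin.last _) : ℚ) =
      |((a : ℕ) : ℚ) - (t + 1 : ℕ)| + if (a : ℕ) = t + 1 then 1 else 0 := by
  have ha := a.isLt
  have h : (((Bgraph (t + s + 4) s).dist a.castSucc (Fin.last _) : ℕ) : ℤ) =
      |((a : ℕ) : ℤ) - (t + 1 : ℕ)| + if (a : ℕ) = t + 1 then 1 else 0 := by
    rw [Bgraph_dist, Bposition, Bposition, abs_eq_max_neg]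
    simp only [Fin.ext_iff, Fin.val_castSucc, Fin.val_last]
    rw [if_neg (show ¬ (a : ℕ) = t + s + 3 by omega)]
    split_ifs <;> omega
  exact_mod_cast h

/-- Wiener index of `B(n,s)`. -/
theorem wiener_Bgraph
    (n s : ℕ) (hn : 4 ≤ n) (hs : s ≤ (n - 4) / 2) :
    wienerIndex (Bgraph n s) =
      (n : ℚ) * ((n : ℚ) - 1) * ((n : ℚ) - 2) / 6 +
        ((s : ℚ) + 1) * ((s : ℚ) + 2) / 2 +
        ((n : ℚ) - s - 3) * ((n : ℚ) - s - 2) / 2 + 1 := by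
  obtain ⟨t, rfl⟩ : ∃ t, n = t + s + 4 := ⟨n - s - 4, by omega⟩
  have h_path : ∑ a : Fin (t + s + 3), ∑ b : Fin (t + s + 3), |((a : ℕ) : ℚ) - (b : ℕ)| =
      ((t + s + 3 : ℕ) + 1 : ℚ) * (t + s + 3 : ℕ) * ((t + s + 3 : ℕ) - 1) / 3 := by
    rw [← sum_range_sum_range_abs_sub, ← Fin.sum_univ_eq_sum_range
      (fun a => ∑ b ∈ range (t + s + 3), |(a : ℚ) - b|)]
    exact sum_congr rfl fun a _ =>
      Fin.sum_univ_eq_sum_range (fun b => |((a : ℕ) : ℚ) - b|) (t + s + 3)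
  have h_twin : ∑ a : Fin (t + s + 3),
      (|((a : ℕ) : ℚ) - (t + 1 : ℕ)| + if (a : ℕ) = t + 1 then 1 else 0) =
      ((t + 1 : ℕ) : ℚ) * ((t + 1 : ℕ) + 1) / 2 + ((s + 1 : ℕ) : ℚ) * ((s + 1 : ℕ) + 1) / 2 + 1 := by
    rw [Fin.sum_univ_eq_sum_range
      (fun a => |(a : ℚ) - (t + 1 : ℕ)| + if a = t + 1 then (1 : ℚ) else 0) (t + s + 3),
      sum_add_distrib, sum_ite_eq', if_pos (mem_range.2 (by omega)),
      ← sum_range_abs_sub_interior, show t + 1 + 1 + (s + 1) = t + s + 3 by omega]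
  rw [wienerIndex]
  simp_rw [Fin.sum_univ_castSucc (n := t + s + 3), dist_comm (u := Fin.last (t + s + 3)),
    dist_self, Bgraph_dist_castSucc, Bgraph_dist_castSucc_last, sum_add_distrib (M := ℚ) (s := univ)
      (f := fun a : Fin (t + s + 3) => ∑ b : Fin (t + s + 3), |((a : ℕ) : ℚ) - (b : ℕ)|)]
  rw [h_path, h_twin]
  push_cast
  ring
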